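/- Let σ ∈ 𝓢'(ℝ^{2d}) be a tempered distribution on ℝ^{2d}. Define the Gabor matrix of the Weyl operator σ^w by M(z,w) = | σ( W(π(z)g, π(w)g) ) | for z, w ∈ ℝ^{2d}, which equals |⟨σ^w π(z)g, π(w)g⟩|. Then the following are equivalent: (i) ∫_{ℝ^{2d}} sup_{u ∈ ℝ^{2d}} |V_G σ(u,ζ)| dζ < ∞ (i.e. σ belongs to the Sjöstrand class M^{∞,1}(ℝ^{2d})); (ii) there exists H ∈ L¹(ℝ^{2d}) such that M(z,w) ≤ H(w − z) for all z, w ∈ ℝ^{2d}. (Almost diagonalization of Weyl operators with Sjöstrand symbols by Gaussian time-frequency shifts.) -/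

import Mathlib

open MeasureTheory Real Filter
open scoped RealInnerProductSpace ENNReal

noncomputable section

/-- The Gaussian window `g(t) = e^{-π|t|²}` on `ℝ^d`. -/
def gaussWindow {d : ℕ} (t : EuclideanSpace ℝ (Fin d)) : ℂ :=
  (Real.exp (-π * ‖t‖ ^ 2) : ℝ)

/-- The Gaussian window `G(u) = e^{-π|u|²}` on phase space `ℝ^{2d} = ℝ^d × ℝ^d`. -/
def gaussWindow2 {d : ℕ} (u : EuclideanSpace ℝ (Fin d) × EuclideanSpace ℝ (Fin d)) : ℂ :=
  (Real.exp (-π * (‖u.1‖ ^ 2 + ‖u.2‖ ^ 2)) : ℝ)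

/-- The squared Euclidean norm on phase space `ℝ^{2d} = ℝ^d × ℝ^d`. -/
def sqNorm2 {d : ℕ} (z : EuclideanSpace ℝ (Fin d) × EuclideanSpace ℝ (Fin d)) : ℝ :=
  ‖z.1‖ ^ 2 + ‖z.2‖ ^ 2

/-- A linear functional `τ` dominated by the supremum of a family of linear functionals `L`
commutes with an integral as soon as every member of `L` does. -/
theorem LinearMap.integral_of_dominated {V I X : Type*} [AddCommGroup V] [Module ℂ V]
    [PseudoMetricSpace X] [MeasurableSpace X] [OpensMeasurableSpace X] [SecondCountableTopology X]
    {μ : Measure X} {L : I → V →ₗ[ℂ] ℂ} {τ : V →ₗ[ℂ] ℂ} {C : ℝ}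
    (hL : ∀ f, ∃ M, ∀ i, ‖L i f‖ ≤ M)
    (hτ : ∀ f M, 0 ≤ M → (∀ i, ‖L i f‖ ≤ M) → ‖τ f‖ ≤ C * M)
    {F : X → V} {K : NNReal} (hLip : ∀ x y i, ‖L i (F x) - L i (F y)‖ ≤ K * dist x y)
    {b : X → ℝ} (hb : Integrable b μ) (hFb : ∀ x i, ‖L i (F x)‖ ≤ b x) (hb0 : ∀ x, 0 ≤ b x)
    {h : V} (hh : ∀ i, L i h = ∫ x, L i (F x) ∂μ) :
    Continuous (fun x => τ (F x)) ∧ Integrable (fun x => τ (F x)) μ ∧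
      τ h = ∫ x, τ (F x) ∂μ := by
  let ι : V →ₗ[ℂ] lp (fun _ : I => ℂ) ∞ :=
    { toFun := fun f => ⟨fun i => L i f, memℓp_infty (by
        obtain ⟨M, hM⟩ := hL f
        exact ⟨M, by rintro _ ⟨i, rfl⟩; exact hM i⟩)⟩
      map_add' := fun f g => by ext i; exact map_add (L i) f g
      map_smul' := fun c f => by ext i; simp }
  have hι : ∀ f i, ι f i = L i f := fun _ _ => rfl
  have hτι : ∀ f, ‖τ f‖ ≤ C * ‖ι f‖ := fun f =>
    hτ f _ (norm_nonneg _) fun i => lp.norm_apply_le_norm (by simp) (ι f) i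
  have hker : LinearMap.ker ι.rangeRestrict ≤ LinearMap.ker τ := fun f hf => by
    have h0 : ι f = 0 := by simpa [LinearMap.ker_rangeRestrict] using hf
    have := hτι f
    rw [h0] at this
    simpa using this
  let τ₀ : LinearMap.range ι →ₗ[ℂ] ℂ :=
    ((LinearMap.ker ι.rangeRestrict).liftQ τ hker).comp
      (ι.rangeRestrict.quotKerEquivOfSurjective ι.surjective_rangeRestrict).symm.toLinearMap
  have hτ₀ : ∀ f, τ₀ (ι.rangeRestrict f) = τ f := fun f => by
    have : (ι.rangeRestrict.quotKerEquivOfSurjective ι.surjective_rangeRestrict).symm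
        (ι.rangeRestrict f) = Submodule.Quotient.mk f := by
      rw [LinearEquiv.symm_apply_eq]; rfl
    simp only [τ₀, LinearMap.comp_apply, LinearEquiv.coe_coe, this, Submodule.liftQ_apply]
  let τ₁ : LinearMap.range ι →L[ℂ] ℂ := τ₀.mkContinuous C (by
    rintro ⟨_, f, rfl⟩
    exact (congrArg norm (hτ₀ f)).trans_le (hτι f))
  obtain ⟨g, hg, -⟩ := exists_extension_norm_eq (LinearMap.range ι) τ₁
  have hgι : ∀ f, g (ι f) = τ f := fun f => (hg (ι.rangeRestrict f)).trans (hτ₀ f)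
  have hcont : Continuous (fun x => ι (F x)) := by
    refine (LipschitzWith.of_dist_le_mul (K := K) fun x y => ?_).continuous
    rw [dist_eq_norm]
    exact lp.norm_le_of_forall_le (by positivity) fun i => hLip x y i
  have hint : Integrable (fun x => ι (F x)) μ :=
    hb.mono' hcont.aestronglyMeasurable (.of_forall fun x =>
      lp.norm_le_of_forall_le (hb0 x) fun i => hFb x i)
  have hιh : ι h = ∫ x, ι (F x) ∂μ := by
    ext i
    have := (lp.evalCLM ℂ (fun _ : I => ℂ) ∞ i).integral_comp_comm hint
    exact (hh i).trans this
  refine ⟨?_, ?_, ?_⟩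
  · simpa only [hgι, Function.comp_def] using g.continuous.comp hcont
  · simpa only [hgι] using g.integrable_comp hint
  · rw [← hgι, hιh, ← g.integral_comp_comm hint]
    simp only [hgι]

section Slices

open SchwartzMap LineDeriv

variable {X V : Type*} [NormedAddCommGroup X] [NormedSpace ℝ X]
  [NormedAddCommGroup V] [NormedSpace ℝ V]

theorem SchwartzMap.lineDerivOp_slice {F : X → 𝓢(V, ℂ)} {Φ : 𝓢(X × V, ℂ)}
    (hF : ∀ x v, F x v = Φ (x, v)) (m : V) (x : X) (v : V) :
    ∂_{m} (F x) v = ∂_{((0 : X), m)} Φ (x, v) := by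
  have h : (F x : V → ℂ) = Φ ∘ fun v => (x, v) := funext fun v => hF x v
  rw [lineDerivOp_apply_eq_fderiv, lineDerivOp_apply_eq_fderiv, h]
  rw [((Φ.hasFDerivAt (x, v)).comp v (hasFDerivAt_prodMk_right x v)).fderiv]
  simp

theorem SchwartzMap.iteratedLineDerivOp_slice {F : X → 𝓢(V, ℂ)} {Φ : 𝓢(X × V, ℂ)}
    (hF : ∀ x v, F x v = Φ (x, v)) {n : ℕ} (m : Fin n → V) (x : X) (v : V) :
    ∂^{m} (F x) v = ∂^{fun i => ((0 : X), m i)} Φ (x, v) := by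
  induction n generalizing x v with
  | zero => simpa using hF x v
  | succ n ih =>
    rw [iteratedLineDerivOp_succ_left, iteratedLineDerivOp_succ_left]
    exact lineDerivOp_slice (F := fun x => ∂^{Fin.tail m} (F x)) (fun x v => ih _ x v) (m 0) x v

/-- Derivatives of a Schwartz function on a product decay in the first variable, uniformly in the
second one and with any polynomial weight in it. -/
theorem SchwartzMap.exists_decay_fst (Φ : 𝓢(X × V, ℂ)) (k n M : ℕ) :
    ∃ C, 0 ≤ C ∧ ∀ x v,
      ‖v‖ ^ k * ‖iteratedFDeriv ℝ n Φ (x, v)‖ ≤ C * (1 + ‖x‖) ^ (-(M : ℝ)) := by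
  refine ⟨2 ^ (k + M) * (Finset.Iic (k + M, n)).sup
    (fun m => SchwartzMap.seminorm ℝ m.1 m.2) Φ, by positivity, fun x v => ?_⟩
  rw [Real.rpow_neg (by positivity), Real.rpow_natCast, ← div_eq_mul_inv,
    le_div_iff₀ (by positivity)]
  refine le_trans ?_ (Φ.one_add_le_sup_seminorm_apply (𝕜 := ℝ) (m := (k + M, n))
    le_rfl le_rfl (x, v))
  rw [mul_right_comm, pow_add]
  have h₁ : ‖v‖ ≤ 1 + ‖(x, v)‖ := (norm_snd_le (x, v)).trans (by simp)
  have h₂ : ‖x‖ ≤ ‖(x, v)‖ := norm_fst_le (x, v)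
  gcongr

theorem SchwartzMap.norm_iteratedFDeriv_sub_le_fst (Φ : 𝓢(X × V, ℂ)) (k n : ℕ) (x y : X) (v : V) :
    ‖v‖ ^ k * ‖iteratedFDeriv ℝ n Φ (x, v) - iteratedFDeriv ℝ n Φ (y, v)‖ ≤
      SchwartzMap.seminorm ℝ k (n + 1) Φ * ‖x - y‖ := by
  have hd : Differentiable ℝ (iteratedFDeriv ℝ n Φ) :=
    (Φ.smooth ⊤).differentiable_iteratedFDeriv (mod_cast ENat.natCast_lt_top n)
  have hD (x : X) : HasFDerivAt (fun x => ‖v‖ ^ k • iteratedFDeriv ℝ n Φ (x, v))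
      (‖v‖ ^ k • (fderiv ℝ (iteratedFDeriv ℝ n Φ) (x, v)).comp (ContinuousLinearMap.inl ℝ X V)) x :=
    (HasFDerivAt.comp (g := iteratedFDeriv ℝ n Φ) (f := fun x => (x, v)) x
      (hd (x, v)).hasFDerivAt (hasFDerivAt_prodMk_left x v)).const_smul (‖v‖ ^ k)
  have := Convex.norm_image_sub_le_of_norm_hasFDerivWithin_le (s := Set.univ) (x := y) (y := x)
    (C := SchwartzMap.seminorm ℝ k (n + 1) Φ) (fun x _ => (hD x).hasFDerivWithinAt)
    (fun x _ => ?_) convex_univ trivial trivial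
  · rwa [← smul_sub, norm_smul, norm_pow, norm_norm] at this
  · refine ContinuousLinearMap.opNorm_le_bound _ (by positivity) fun u => ?_
    rw [_root_.smul_apply, norm_smul, norm_pow, norm_norm]
    calc ‖v‖ ^ k * ‖fderiv ℝ (iteratedFDeriv ℝ n Φ) (x, v) (u, 0)‖
        ≤ ‖(x, v)‖ ^ k * (‖iteratedFDeriv ℝ (n + 1) Φ (x, v)‖ * ‖((u, 0) : X × V)‖) := by
          gcongr
          · exact norm_snd_le (x, v)
          · rw [← norm_fderiv_iteratedFDeriv]
            exact ContinuousLinearMap.le_opNorm _ _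
      _ = ‖(x, v)‖ ^ k * ‖iteratedFDeriv ℝ (n + 1) Φ (x, v)‖ * ‖u‖ := by
          simp [Prod.norm_def, mul_assoc]
      _ ≤ _ := by gcongr; exact Φ.le_seminorm ℝ k (n + 1) (x, v)

variable [MeasurableSpace X] [BorelSpace X] [FiniteDimensional ℝ X]
  {μ : Measure X} [μ.IsAddHaarMeasure]

theorem integrable_one_add_norm_neg_finrank (μ : Measure X) [μ.IsAddHaarMeasure] :
    Integrable (fun x : X => (1 + ‖x‖) ^ (-((Module.finrank ℝ X + 1 : ℕ) : ℝ))) μ :=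
  integrable_one_add_norm (by push_cast; linarith)

theorem SchwartzMap.integrable_slice (Φ : 𝓢(X × V, ℂ)) (v : V) :
    Integrable (fun x => Φ (x, v)) μ := by
  obtain ⟨C, -, hC⟩ := Φ.exists_decay_fst 0 0 (Module.finrank ℝ X + 1)
  refine ((integrable_one_add_norm_neg_finrank μ).const_mul C).mono'
    (Φ.continuous.comp (by fun_prop : Continuous fun x : X => (x, v))).aestronglyMeasurable
    (.of_forall fun x => by simpa using hC x v)

theorem SchwartzMap.lineDerivOp_integral_slice {h : 𝓢(V, ℂ)} {Φ : 𝓢(X × V, ℂ)}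
    (hh : ∀ v, h v = ∫ x, Φ (x, v) ∂μ) (m v : V) :
    ∂_{m} h v = ∫ x, ∂_{((0 : X), m)} Φ (x, v) ∂μ := by
  obtain ⟨C, -, hC⟩ := (∂_{((0 : X), m)} Φ).exists_decay_fst 0 0 (Module.finrank ℝ X + 1)
  have hderiv (x : X) (t : ℝ) : HasDerivAt (fun t : ℝ => Φ (x, v + t • m))
      (∂_{((0 : X), m)} Φ (x, v + t • m)) t := by
    have hl : HasDerivAt (fun t : ℝ => (x, v + t • m)) ((0 : X), m) t := by
      simpa using (hasDerivAt_const t x).prodMk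
        (((hasDerivAt_id t).smul_const m).const_add v)
    exact (Φ.hasFDerivAt (x, v + t • m)).comp_hasDerivAt t hl
  have key := (hasDerivAt_integral_of_dominated_loc_of_deriv_le (μ := μ) (s := Set.univ)
    (F := fun (t : ℝ) x => Φ (x, v + t • m)) (x₀ := (0 : ℝ))
    (F' := fun t x => ∂_{((0 : X), m)} Φ (x, v + t • m)) Filter.univ_mem
    (.of_forall fun t => (Φ.integrable_slice (v + t • m)).aestronglyMeasurable)
    (Φ.integrable_slice _) ((∂_{((0 : X), m)} Φ).integrable_slice _).aestronglyMeasurable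
    (.of_forall fun x t _ => by simpa using hC x (v + t • m))
    ((integrable_one_add_norm_neg_finrank μ).const_mul C)
    (.of_forall fun x t _ => hderiv x t)).2
  simp only [← hh, zero_smul, add_zero] at key
  have hl : HasDerivAt (fun t : ℝ => v + t • m) m 0 := by
    simpa using ((hasDerivAt_id (0 : ℝ)).smul_const m).const_add v
  have := (h.hasFDerivAt (v + (0 : ℝ) • m)).comp_hasDerivAt (0 : ℝ) hl
  simp only [zero_smul, add_zero] at this
  exact this.unique key

theorem SchwartzMap.iteratedLineDerivOp_integral_slice {h : 𝓢(V, ℂ)} {Φ : 𝓢(X × V, ℂ)}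
    (hh : ∀ v, h v = ∫ x, Φ (x, v) ∂μ) {n : ℕ} (m : Fin n → V) (v : V) :
    ∂^{m} h v = ∫ x, ∂^{fun i => ((0 : X), m i)} Φ (x, v) ∂μ := by
  induction n generalizing v with
  | zero => simpa using hh v
  | succ n ih =>
    simp only [iteratedLineDerivOp_succ_left]
    exact lineDerivOp_integral_slice (fun v => ih _ v) (m 0) v

/-- The functional `f ↦ |v|^k D^n f(v)(m) / ∏ |m i|` on Schwartz space. -/
def SchwartzMap.weightedDeriv (k n : ℕ) (v : V) (m : Fin n → V) : 𝓢(V, ℂ) →ₗ[ℂ] ℂ where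
  toFun f := ((‖v‖ ^ k * (∏ i, ‖m i‖)⁻¹ : ℝ) : ℂ) * ∂^{m} f v
  map_add' f g := by rw [iteratedLineDerivOp_add, add_apply, mul_add]
  map_smul' c f := by
    rw [iteratedLineDerivOp_smul, smul_apply, smul_eq_mul, RingHom.id_apply, smul_eq_mul,
      mul_left_comm]

theorem SchwartzMap.norm_weightedDeriv (k n : ℕ) (v : V) (m : Fin n → V) (f : 𝓢(V, ℂ)) :
    ‖weightedDeriv k n v m f‖ =
      ‖v‖ ^ k * (‖iteratedFDeriv ℝ n f v m‖ / ∏ i, ‖m i‖) := by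
  have : 0 ≤ ‖v‖ ^ k * (∏ i, ‖m i‖)⁻¹ := by positivity
  rw [weightedDeriv, LinearMap.coe_mk, AddHom.coe_mk, norm_mul, Complex.norm_real,
    Real.norm_of_nonneg this, iteratedLineDerivOp_eq_iteratedFDeriv]
  ring

theorem SchwartzMap.norm_weightedDeriv_le (k n : ℕ) (v : V) (m : Fin n → V) (f : 𝓢(V, ℂ)) :
    ‖weightedDeriv k n v m f‖ ≤ SchwartzMap.seminorm ℂ k n f := by
  rw [norm_weightedDeriv]
  refine le_trans ?_ (f.le_seminorm ℂ k n v)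
  gcongr
  exact div_le_of_le_mul₀ (by positivity) (by positivity) (ContinuousMultilinearMap.le_opNorm _ _)

theorem SchwartzMap.seminorm_le_of_weightedDeriv {k n : ℕ} {f : 𝓢(V, ℂ)} {M : ℝ} (hM : 0 ≤ M)
    (h : ∀ v m, ‖weightedDeriv k n v m f‖ ≤ M) : SchwartzMap.seminorm ℂ k n f ≤ M := by
  refine seminorm_le_bound ℂ k n f hM fun v => ?_
  have key : ‖(‖v‖ ^ k) • iteratedFDeriv ℝ n f v‖ ≤ M := by
    refine ContinuousMultilinearMap.opNorm_le_bound hM fun m => ?_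
    by_cases hm : ∃ i, m i = 0
    · obtain ⟨i, hi⟩ := hm
      rw [ContinuousMultilinearMap.map_coord_zero _ i hi, norm_zero]
      positivity
    · push Not at hm
      have hpos : 0 < ∏ i, ‖m i‖ := Finset.prod_pos fun i _ => norm_pos_iff.2 (hm i)
      have := h v m
      rw [norm_weightedDeriv, ← mul_div_assoc, div_le_iff₀ hpos] at this
      simpa [norm_smul] using this
  simpa [norm_smul] using key

/-- A tempered distribution commutes with the integral of the slices of a Schwartz function on a
product. -/
theorem SchwartzMap.integral_slices (σ : 𝓢(V, ℂ) →L[ℂ] ℂ) {F : X → 𝓢(V, ℂ)} {Φ : 𝓢(X × V, ℂ)}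
    (hF : ∀ x v, F x v = Φ (x, v)) {h : 𝓢(V, ℂ)} (hh : ∀ v, h v = ∫ x, F x v ∂μ) :
    Continuous (fun x => σ (F x)) ∧ Integrable (fun x => σ (F x)) μ ∧
      σ h = ∫ x, σ (F x) ∂μ := by
  obtain ⟨s, C, -, hσ⟩ := Seminorm.bound_of_continuous (schwartz_withSeminorms ℂ V ℂ)
    ((normSeminorm ℂ ℂ).comp σ.toLinearMap) (continuous_norm.comp σ.continuous)
  choose D hD0 hD using fun p : ℕ × ℕ => Φ.exists_decay_fst p.1 p.2 (Module.finrank ℝ X + 1)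
  have hFΦ (p : ℕ × ℕ) (v : V) (m : Fin p.2 → V) (x : X) : weightedDeriv p.1 p.2 v m (F x) =
      ((‖v‖ ^ p.1 * (∏ i, ‖m i‖)⁻¹ : ℝ) : ℂ) *
        iteratedFDeriv ℝ p.2 Φ (x, v) (fun i => (0, m i)) := by
    rw [weightedDeriv, LinearMap.coe_mk, AddHom.coe_mk, iteratedLineDerivOp_slice hF,
      iteratedLineDerivOp_eq_iteratedFDeriv]
  have hmul (p : ℕ × ℕ) (v : V) (m : Fin p.2 → V)
      (A : ContinuousMultilinearMap ℝ (fun _ : Fin p.2 => X × V) ℂ) :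
      ‖((‖v‖ ^ p.1 * (∏ i, ‖m i‖)⁻¹ : ℝ) : ℂ) * A (fun i => (0, m i))‖ ≤ ‖v‖ ^ p.1 * ‖A‖ := by
    have h0 : 0 ≤ ‖v‖ ^ p.1 * (∏ i, ‖m i‖)⁻¹ := by positivity
    rw [norm_mul, Complex.norm_real, Real.norm_of_nonneg h0, mul_assoc, mul_comm _ ‖A _‖,
      ← div_eq_mul_inv]
    gcongr
    refine div_le_of_le_mul₀ (by positivity) (by positivity) ((A.le_opNorm _).trans_eq ?_)
    simp [Prod.norm_def]
  refine LinearMap.integral_of_dominated (I := Σ p : s, V × (Fin p.1.2 → V))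
    (L := fun i => weightedDeriv i.1.1.1 i.1.1.2 i.2.1 i.2.2) (τ := σ.toLinearMap) (C := C)
    (K := ⟨∑ p ∈ s, SchwartzMap.seminorm ℝ p.1 (p.2 + 1) Φ, by positivity⟩)
    (b := fun x => (∑ p ∈ s, D p) * (1 + ‖x‖) ^ (-((Module.finrank ℝ X + 1 : ℕ) : ℝ)))
    (fun f => ⟨∑ p ∈ s, SchwartzMap.seminorm ℂ p.1 p.2 f, ?_⟩) (fun f M hM hf => ?_)
    (fun x y => ?_) ((integrable_one_add_norm_neg_finrank μ).const_mul _) (fun x => ?_)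
    (fun x => ?_) ?_
  · rintro ⟨p, v, m⟩
    exact (norm_weightedDeriv_le _ _ _ _ _).trans
      (Finset.single_le_sum (f := fun p : ℕ × ℕ => SchwartzMap.seminorm ℂ p.1 p.2 f)
        (fun p _ => apply_nonneg _ _) p.2)
  · refine (hσ f).trans ?_
    rw [_root_.smul_apply, NNReal.smul_def, smul_eq_mul]
    gcongr
    exact Seminorm.finset_sup_apply_le hM fun p hp =>
      seminorm_le_of_weightedDeriv hM fun v m => hf ⟨⟨p, hp⟩, v, m⟩
  · rintro ⟨p, v, m⟩
    rw [hFΦ, hFΦ, ← mul_sub, ← _root_.sub_apply, dist_eq_norm]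
    refine (hmul _ _ _ _).trans ((Φ.norm_iteratedFDeriv_sub_le_fst _ _ _ _ _).trans ?_)
    gcongr
    exact Finset.single_le_sum (f := fun p : ℕ × ℕ => SchwartzMap.seminorm ℝ p.1 (p.2 + 1) Φ)
        (fun p _ => apply_nonneg _ _) p.2
  · rintro ⟨p, v, m⟩
    rw [hFΦ]
    refine (hmul _ _ _ _).trans ((hD p x v).trans ?_)
    gcongr
    exact Finset.single_le_sum (f := D) (fun p _ => hD0 p) p.2
  · have := Finset.sum_nonneg fun p (_ : p ∈ s) => hD0 p
    positivity
  · rintro ⟨p, v, m⟩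
    simp only [hFΦ]
    rw [integral_const_mul, weightedDeriv, LinearMap.coe_mk, AddHom.coe_mk,
      iteratedLineDerivOp_integral_slice (μ := μ) (Φ := Φ) (by simpa only [← hF] using hh)]
    simp only [iteratedLineDerivOp_eq_iteratedFDeriv]

end Slices

section Tensor

open SchwartzMap

variable {X V : Type*} [NormedAddCommGroup X] [NormedSpace ℝ X]
  [NormedAddCommGroup V] [NormedSpace ℝ V]

theorem ContinuousLinearMap.norm_iteratedFDeriv_comp_right_le {L : X →L[ℝ] V} (hL : ‖L‖ ≤ 1)
    (f : 𝓢(V, ℂ)) (n : ℕ) (x : X) :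
    ‖iteratedFDeriv ℝ n (fun x => f (L x)) x‖ ≤ ‖iteratedFDeriv ℝ n f (L x)‖ := by
  have := L.iteratedFDeriv_comp_right (f.smooth n) x le_rfl
  rw [Function.comp_def] at this
  rw [this]
  refine (ContinuousMultilinearMap.norm_compContinuousLinearMap_le _ _).trans ?_
  exact mul_le_of_le_one_right (norm_nonneg _) (Finset.prod_le_one (by simp) fun _ _ => hL)

/-- The tensor product `(x, v) ↦ f x * g v` of two Schwartz functions. -/
def SchwartzMap.tensor (f : 𝓢(X, ℂ)) (g : 𝓢(V, ℂ)) : 𝓢(X × V, ℂ) where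
  toFun p := f p.1 * g p.2
  smooth' := ((f.smooth ⊤).comp contDiff_fst).mul ((g.smooth ⊤).comp contDiff_snd)
  decay' k n := by
    let p (k n : ℕ) (f : 𝓢(X, ℂ)) := SchwartzMap.seminorm ℝ k n f
    let q (k n : ℕ) (g : 𝓢(V, ℂ)) := SchwartzMap.seminorm ℝ k n g
    refine ⟨∑ i ∈ Finset.range (n + 1), n.choose i *
      (p k i f * q 0 (n - i) g + p 0 i f * q k (n - i) g), fun ⟨x, v⟩ => ?_⟩
    have hfg := norm_iteratedFDeriv_mul_le ((f.smooth n).comp contDiff_fst)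
      ((g.smooth n).comp contDiff_snd) (x, v) le_rfl
    refine (mul_le_mul_of_nonneg_left hfg (by positivity)).trans ?_
    rw [Finset.mul_sum]
    refine Finset.sum_le_sum fun i _ => ?_
    have hf := ContinuousLinearMap.norm_iteratedFDeriv_comp_right_le
      (ContinuousLinearMap.norm_fst_le ℝ X V) f i (x, v)
    have hg := ContinuousLinearMap.norm_iteratedFDeriv_comp_right_le
      (ContinuousLinearMap.norm_snd_le ℝ X V) g (n - i) (x, v)
    have hk : ‖(x, v)‖ ^ k ≤ ‖x‖ ^ k + ‖v‖ ^ k := by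
      rcases max_cases ‖x‖ ‖v‖ with h | h <;> rw [Prod.norm_def, h.1] <;> simp
    have hf0 := f.norm_iteratedFDeriv_le_seminorm ℝ i x
    have hfk := f.le_seminorm ℝ k i x
    have hg0 := g.norm_iteratedFDeriv_le_seminorm ℝ (n - i) v
    have hgk := g.le_seminorm ℝ k (n - i) v
    calc _ ≤ (‖x‖ ^ k + ‖v‖ ^ k) * (n.choose i * ‖iteratedFDeriv ℝ i f x‖ *
          ‖iteratedFDeriv ℝ (n - i) g v‖) := by
          gcongr
          · exact hf
          · exact hg
      _ = n.choose i * ((‖x‖ ^ k * ‖iteratedFDeriv ℝ i f x‖) * ‖iteratedFDeriv ℝ (n - i) g v‖ +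
          ‖iteratedFDeriv ℝ i f x‖ * (‖v‖ ^ k * ‖iteratedFDeriv ℝ (n - i) g v‖)) := by ring
      _ ≤ _ := by gcongr

theorem SchwartzMap.tensor_apply (f : 𝓢(X, ℂ)) (g : 𝓢(V, ℂ)) (p : X × V) :
    f.tensor g p = f p.1 * g p.2 := rfl

theorem hasTemperateGrowth_cexp_ofReal_mul_I :
    Function.HasTemperateGrowth (fun t : ℝ => Complex.exp (t * Complex.I)) := by
  have hn (n : ℕ) : iteratedDeriv n (fun t : ℝ => Complex.exp (t * Complex.I)) =
      fun t : ℝ => Complex.I ^ n * Complex.exp (t * Complex.I) := by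
    induction n with
    | zero => simp
    | succ n ih =>
      rw [iteratedDeriv_succ, ih]
      ext t
      have h : HasDerivAt (fun t : ℝ => Complex.exp (t * Complex.I))
          (Complex.exp (t * Complex.I) * Complex.I) t := by
        simpa using ((Complex.ofRealCLM.hasDerivAt (x := t)).mul_const Complex.I).cexp
      rw [(h.const_mul (Complex.I ^ n)).deriv]
      ring
  refine ⟨(Complex.ofRealCLM.contDiff.mul contDiff_const).cexp, fun n => ⟨0, 1, fun t => ?_⟩⟩
  rw [norm_iteratedFDeriv_eq_norm_iteratedDeriv, hn]
  simp [Complex.norm_exp_ofReal_mul_I]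

end Tensor

section Gabor

variable {d : ℕ}

/-- Phase space `ℝ^d × ℝ^d`. -/
abbrev PhaseSpace (d : ℕ) : Type := EuclideanSpace ℝ (Fin d) × EuclideanSpace ℝ (Fin d)

instance : (volume : Measure (PhaseSpace d)).IsAddHaarMeasure :=
  Measure.prod.instIsAddHaarMeasure _ _

instance : (volume : Measure (PhaseSpace d)).IsNegInvariant :=
  ⟨((Measure.measurePreserving_neg volume).prod (Measure.measurePreserving_neg volume)).map_eq⟩

/-- The Euclidean inner product on phase space. -/
def phaseInner (u v : PhaseSpace d) : ℝ := ⟪u.1, v.1⟫ + ⟪u.2, v.2⟫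

theorem phaseInner_sub_left (u u' v : PhaseSpace d) :
    phaseInner (u - u') v = phaseInner u v - phaseInner u' v := by
  simp [phaseInner, inner_sub_left]; ring

theorem phaseInner_sub_right (u v v' : PhaseSpace d) :
    phaseInner u (v - v') = phaseInner u v - phaseInner u v' := by
  simp [phaseInner, inner_sub_right]; ring

theorem phaseInner_comm (u v : PhaseSpace d) : phaseInner u v = phaseInner v u := by
  simp [phaseInner, real_inner_comm]

/-- The Gaussian `v ↦ e^{-2πi ζ·v} e^{-α|v-u|²}` on phase space. -/
def gaborAtom (α : ℝ) (u ζ v : PhaseSpace d) : ℂ :=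
  Complex.exp (((-(2 * π * phaseInner ζ v) : ℝ) : ℂ) * Complex.I) *
    ((Real.exp (-α * sqNorm2 (v - u)) : ℝ) : ℂ)

theorem norm_gaborAtom (α : ℝ) (u ζ v : PhaseSpace d) :
    ‖gaborAtom α u ζ v‖ = Real.exp (-α * sqNorm2 (v - u)) := by
  rw [gaborAtom, norm_mul, Complex.norm_exp_ofReal_mul_I, one_mul, Complex.norm_real,
    Real.norm_of_nonneg (Real.exp_nonneg _)]

theorem sqNorm2_nonneg (v : PhaseSpace d) : 0 ≤ sqNorm2 v := by
  unfold sqNorm2; positivity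

theorem norm_gaborAtom_zero_le_one {α : ℝ} (hα : 0 ≤ α) (u ζ v : PhaseSpace d) :
    ‖gaborAtom α u ζ v‖ ≤ 1 := by
  rw [norm_gaborAtom, Real.exp_le_one_iff]
  nlinarith [sqNorm2_nonneg (v - u)]

theorem gaborAtom_ne_zero (α : ℝ) (u ζ v : PhaseSpace d) : gaborAtom α u ζ v ≠ 0 := by
  simp [← norm_ne_zero_iff, norm_gaborAtom, Real.exp_ne_zero]

theorem integral_gaussian_phase {α : ℝ} (hα : 0 < α) (ξ : EuclideanSpace ℝ (Fin d)) :
    ∫ y : EuclideanSpace ℝ (Fin d), Complex.exp (((-(2 * π * ⟪ξ, y⟫) : ℝ) : ℂ) * Complex.I) *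
      ((Real.exp (-α * ‖y‖ ^ 2) : ℝ) : ℂ) =
    ((π / α : ℝ) : ℂ) ^ (d / 2 : ℂ) * ((Real.exp (-(π ^ 2 / α) * ‖ξ‖ ^ 2) : ℝ) : ℂ) := by
  have := GaussianFourier.integral_cexp_neg_mul_sq_norm_add (V := EuclideanSpace ℝ (Fin d))
    (b := α) (by simpa using hα) (-(2 * π * Complex.I)) ξ
  have hα' : (α : ℂ) ≠ 0 := mod_cast hα.ne'
  convert this using 3
  · rw [Complex.ofReal_exp, ← Complex.exp_add]
    push_cast
    ring_nf
  · push_cast; rfl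
  · simp
  · rw [Complex.ofReal_exp]
    congr 1
    push_cast
    field_simp
    rw [Complex.I_sq]
    ring

theorem integral_gaborAtom_zero {α : ℝ} (hα : 0 < α) (ξ : PhaseSpace d) :
    ∫ y : PhaseSpace d, gaborAtom α 0 ξ y =
    (((π / α : ℝ) : ℂ) ^ (d / 2 : ℂ)) ^ 2 *
      ((Real.exp (-(π ^ 2 / α) * sqNorm2 ξ) : ℝ) : ℂ) := by
  have h (y : PhaseSpace d) : gaborAtom α 0 ξ y =
      (Complex.exp (((-(2 * π * ⟪ξ.1, y.1⟫) : ℝ) : ℂ) * Complex.I) *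
        ((Real.exp (-α * ‖y.1‖ ^ 2) : ℝ) : ℂ)) *
      (Complex.exp (((-(2 * π * ⟪ξ.2, y.2⟫) : ℝ) : ℂ) * Complex.I) *
        ((Real.exp (-α * ‖y.2‖ ^ 2) : ℝ) : ℂ)) := by
    simp only [gaborAtom, phaseInner, sqNorm2, sub_zero, Complex.ofReal_exp, ← Complex.exp_add]
    congr 1
    push_cast
    ring
  simp only [h]
  rw [Measure.volume_eq_prod, integral_prod_mul
    (fun y => Complex.exp (((-(2 * π * ⟪ξ.1, y⟫) : ℝ) : ℂ) * Complex.I) *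
        ((Real.exp (-α * ‖y‖ ^ 2) : ℝ) : ℂ))
    (fun y => Complex.exp (((-(2 * π * ⟪ξ.2, y⟫) : ℝ) : ℂ) * Complex.I) *
        ((Real.exp (-α * ‖y‖ ^ 2) : ℝ) : ℂ)),
    integral_gaussian_phase hα, integral_gaussian_phase hα]
  simp only [sqNorm2, Complex.ofReal_exp, mul_add, Complex.ofReal_add, Complex.exp_add]
  ring

open SchwartzMap

theorem hasTemperateGrowth_chirp : Function.HasTemperateGrowth
    (fun p : PhaseSpace d × PhaseSpace d =>
      Complex.exp (((2 * π * phaseInner p.1 p.2 : ℝ) : ℂ) * Complex.I)) := by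
  let B : EuclideanSpace ℝ (Fin d) →L[ℝ] EuclideanSpace ℝ (Fin d) →L[ℝ] ℝ := innerSL ℝ
  let π₁ := ContinuousLinearMap.fst ℝ (PhaseSpace d) (PhaseSpace d)
  let π₂ := ContinuousLinearMap.snd ℝ (PhaseSpace d) (PhaseSpace d)
  let ρ₁ := ContinuousLinearMap.fst ℝ (EuclideanSpace ℝ (Fin d)) (EuclideanSpace ℝ (Fin d))
  let ρ₂ := ContinuousLinearMap.snd ℝ (EuclideanSpace ℝ (Fin d)) (EuclideanSpace ℝ (Fin d))
  have h₁ := B.bilinear_hasTemperateGrowth (ρ₁.comp π₁).hasTemperateGrowth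
    (ρ₁.comp π₂).hasTemperateGrowth
  have h₂ := B.bilinear_hasTemperateGrowth (ρ₂.comp π₁).hasTemperateGrowth
    (ρ₂.comp π₂).hasTemperateGrowth
  exact hasTemperateGrowth_cexp_ofReal_mul_I.comp
    ((Function.HasTemperateGrowth.const (2 * π)).mul (h₁.add h₂))

/-- The shear `(s, v) ↦ (s, v - s)`. -/
def shearEquiv (X : Type*) [NormedAddCommGroup X] [NormedSpace ℝ X] : (X × X) ≃L[ℝ] (X × X) :=
  .equivOfInverse
    ((ContinuousLinearMap.fst ℝ X X).prod
      (ContinuousLinearMap.snd ℝ X X - ContinuousLinearMap.fst ℝ X X))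
    ((ContinuousLinearMap.fst ℝ X X).prod
      (ContinuousLinearMap.snd ℝ X X + ContinuousLinearMap.fst ℝ X X))
    (fun p => by simp) (fun p => by simp)

variable {win win₂ : PhaseSpace d → PhaseSpace d → 𝓢(PhaseSpace d, ℂ)}

theorem gaborAtom_mul_gaborAtom (u ζ η v : PhaseSpace d) :
    gaborAtom π 0 u η * gaborAtom π u (ζ - η) v =
      gaborAtom π u ζ v * gaborAtom π 0 (u - v) η := by
  simp only [gaborAtom, phaseInner_sub_left, sub_zero, Complex.ofReal_exp, ← Complex.exp_add]
  congr 1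
  rw [phaseInner_comm η v]
  push_cast
  ring

/-- A narrow Gaussian is a superposition of modulations of a wide one. -/
theorem narrow_eq_integral (hwin : ∀ u ζ v, win u ζ v = gaborAtom π u ζ v)
    (hwin₂ : ∀ u ζ v, win₂ u ζ v = gaborAtom (2 * π) u ζ v)
    (σ : 𝓢(PhaseSpace d, ℂ) →L[ℂ] ℂ) (u ζ : PhaseSpace d) :
    Continuous (fun η => win 0 u η * σ (win u (ζ - η))) ∧
      σ (win₂ u ζ) = ∫ η, win 0 u η * σ (win u (ζ - η)) := by
  have h := integral_slices (μ := volume) σ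
    (F := fun η => win 0 u η • win u (ζ - η))
    (Φ := smulLeftCLM ℂ (fun p : PhaseSpace d × PhaseSpace d =>
      Complex.exp (((2 * π * phaseInner p.1 p.2 : ℝ) : ℂ) * Complex.I))
      ((win 0 u).tensor (win u ζ))) (h := win₂ u ζ) (fun η v => ?_) (fun v => ?_)
  · simp only [map_smul, smul_eq_mul] at h
    exact ⟨h.1, h.2.2⟩
  · rw [smulLeftCLM_apply_apply hasTemperateGrowth_chirp, tensor_apply, _root_.smul_apply]
    simp only [hwin, smul_eq_mul, gaborAtom, phaseInner_sub_left, sub_zero, Complex.ofReal_exp,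
      ← Complex.exp_add]
    congr 1
    push_cast
    ring
  · simp only [_root_.smul_apply, hwin, hwin₂, smul_eq_mul, gaborAtom_mul_gaborAtom]
    rw [integral_const_mul, integral_gaborAtom_zero pi_pos]
    have h₁ : π ^ 2 / π = π := by field_simp
    have h₂ : sqNorm2 (u - v) = sqNorm2 (v - u) := by simp [sqNorm2, norm_sub_rev]
    rw [h₁, h₂, div_self pi_ne_zero, Complex.ofReal_one, Complex.one_cpow, one_pow, one_mul]
    simp only [gaborAtom, Complex.ofReal_exp, ← Complex.exp_add]
    congr 1
    push_cast
    ring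

theorem gaborAtom_mul_gaborAtom_add (u ζ s v : PhaseSpace d) :
    gaborAtom (2 * π) 0 0 s * gaborAtom (2 * π) (u + s) ζ v =
      gaborAtom π u ζ v * gaborAtom (4 * π) 0 0 (s - (1 / 2 : ℝ) • (v - u)) := by
  have key (a b : EuclideanSpace ℝ (Fin d)) :
      2 * (‖a‖ ^ 2 + ‖b - a‖ ^ 2) = ‖b‖ ^ 2 + 4 * ‖a - (1 / 2 : ℝ) • b‖ ^ 2 := by
    rw [norm_sub_sq_real, norm_sub_sq_real, norm_smul, inner_smul_right, real_inner_comm]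
    norm_num
    ring
  have h₁ := key s.1 (v - u).1
  have h₂ := key s.2 (v - u).2
  have h0 (x : PhaseSpace d) : phaseInner 0 x = 0 := by simp [phaseInner]
  simp only [gaborAtom, h0, sqNorm2, sub_zero, Complex.ofReal_exp, ← Complex.exp_add]
  congr 1
  have h₃ : v - (u + s) = v - u - s := by abel
  rw [h₃]
  have : (2 : ℂ) * (((‖s.1‖ ^ 2 + ‖(v - u - s).1‖ ^ 2 + (‖s.2‖ ^ 2 + ‖(v - u - s).2‖ ^ 2) : ℝ)) : ℂ)
      = ((‖(v - u).1‖ ^ 2 + 4 * ‖(s - (1 / 2 : ℝ) • (v - u)).1‖ ^ 2 +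
        (‖(v - u).2‖ ^ 2 + 4 * ‖(s - (1 / 2 : ℝ) • (v - u)).2‖ ^ 2) : ℝ) : ℂ) := by
    rw [← Complex.ofReal_ofNat, ← Complex.ofReal_mul]
    congr 1
    simp only [Prod.fst_sub, Prod.snd_sub, Prod.smul_fst, Prod.smul_snd] at h₁ h₂ ⊢
    linarith
  push_cast at this ⊢
  linear_combination (-(π : ℂ)) * this

/-- A wide Gaussian is a superposition of translations of a narrow one. -/
theorem wide_eq_integral (hwin : ∀ u ζ v, win u ζ v = gaborAtom π u ζ v)
    (hwin₂ : ∀ u ζ v, win₂ u ζ v = gaborAtom (2 * π) u ζ v)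
    (σ : 𝓢(PhaseSpace d, ℂ) →L[ℂ] ℂ) (u ζ : PhaseSpace d) :
    (((π / (4 * π) : ℝ) : ℂ) ^ (d / 2 : ℂ)) ^ 2 * σ (win u ζ) =
      ∫ s, win₂ 0 0 s * σ (win₂ (u + s) ζ) := by
  have h := integral_slices (μ := volume) σ
    (F := fun s => win₂ 0 0 s • win₂ (u + s) ζ)
    (Φ := compCLMOfContinuousLinearEquiv ℂ (shearEquiv (PhaseSpace d))
      ((win₂ 0 ζ).tensor (win₂ u ζ)))
    (h := (((π / (4 * π) : ℝ) : ℂ) ^ (d / 2 : ℂ)) ^ 2 • win u ζ) (fun s v => ?_) (fun v => ?_)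
  · simp only [map_smul, smul_eq_mul] at h
    exact h.2.2
  · change _ = (win₂ 0 ζ).tensor (win₂ u ζ) (s, v - s)
    rw [tensor_apply, _root_.smul_apply]
    have h0 (x : PhaseSpace d) : phaseInner 0 x = 0 := by simp [phaseInner]
    have h₃ : v - (u + s) = v - s - u := by abel
    simp only [hwin₂, smul_eq_mul, gaborAtom, phaseInner_sub_right, sub_zero, h0, h₃,
      Complex.ofReal_exp, ← Complex.exp_add]
    congr 1
    push_cast
    ring
  · simp only [_root_.smul_apply, hwin, hwin₂, smul_eq_mul, gaborAtom_mul_gaborAtom_add]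
    rw [integral_const_mul, integral_sub_right_eq_self (fun s => gaborAtom (4 * π) 0 0 s),
      integral_gaborAtom_zero (by positivity)]
    simp [sqNorm2, mul_comm]

end Gabor

section Wigner

variable {d : ℕ}

theorem wigner_gaussWindow_integrand (z w : PhaseSpace d) (x ξ y : EuclideanSpace ℝ (Fin d)) :
    Complex.exp (-(((2 * π * ⟪y - (w.1 - z.1), ξ⟫ : ℝ) : ℂ) * Complex.I)) *
        (Complex.exp (((2 * π * ⟪z.2, x + (1 / 2 : ℝ) • (y - (w.1 - z.1))⟫ : ℝ) : ℂ) * Complex.I) *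
          gaussWindow (x + (1 / 2 : ℝ) • (y - (w.1 - z.1)) - z.1)) *
        (starRingEnd ℂ) (Complex.exp
          (((2 * π * ⟪w.2, x - (1 / 2 : ℝ) • (y - (w.1 - z.1))⟫ : ℝ) : ℂ) * Complex.I) *
          gaussWindow (x - (1 / 2 : ℝ) • (y - (w.1 - z.1)) - w.1)) =
      (Complex.exp (((2 * π * ⟪w.1 - z.1, ξ⟫ - 2 * π * ⟪w.2 - z.2, x⟫ -
          π * ⟪w.1 - z.1, z.2 + w.2⟫ : ℝ) : ℂ) * Complex.I) *
        ((Real.exp (-(2 * π) * ‖x - (1 / 2 : ℝ) • (z.1 + w.1)‖ ^ 2) : ℝ) : ℂ)) *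
      (Complex.exp (((-(2 * π * ⟪ξ - (1 / 2 : ℝ) • (z.2 + w.2), y⟫) : ℝ) : ℂ) * Complex.I) *
        ((Real.exp (-(π / 2) * ‖y‖ ^ 2) : ℝ) : ℂ)) := by
  have hphase : -⟪y - (w.1 - z.1), ξ⟫ + ⟪z.2, x + (1 / 2 : ℝ) • (y - (w.1 - z.1))⟫ -
      ⟪w.2, x - (1 / 2 : ℝ) • (y - (w.1 - z.1))⟫ =
      ⟪w.1 - z.1, ξ⟫ - ⟪w.2 - z.2, x⟫ - 1 / 2 * ⟪w.1 - z.1, z.2 + w.2⟫ -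
        ⟪ξ - (1 / 2 : ℝ) • (z.2 + w.2), y⟫ := by
    simp only [inner_add_left, inner_add_right, inner_sub_left, inner_sub_right,
      inner_smul_left, inner_smul_right, real_inner_comm, conj_trivial]
    ring
  have hnorm : ‖x + (1 / 2 : ℝ) • (y - (w.1 - z.1)) - z.1‖ ^ 2 +
      ‖x - (1 / 2 : ℝ) • (y - (w.1 - z.1)) - w.1‖ ^ 2 =
      2 * ‖x - (1 / 2 : ℝ) • (z.1 + w.1)‖ ^ 2 + 1 / 2 * ‖y‖ ^ 2 := by
    have h₁ : x + (1 / 2 : ℝ) • (y - (w.1 - z.1)) - z.1 =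
        (x - (1 / 2 : ℝ) • (z.1 + w.1)) + (1 / 2 : ℝ) • y := by module
    have h₂ : x - (1 / 2 : ℝ) • (y - (w.1 - z.1)) - w.1 =
        (x - (1 / 2 : ℝ) • (z.1 + w.1)) - (1 / 2 : ℝ) • y := by module
    rw [h₁, h₂, norm_add_sq_real, norm_sub_sq_real _ ((1 / 2 : ℝ) • y), norm_smul,
      Real.norm_of_nonneg (by norm_num)]
    ring
  have hphase' := congrArg (fun r : ℝ => (r : ℂ)) hphase
  have hnorm' := congrArg (fun r : ℝ => (r : ℂ)) hnorm
  simp only [gaussWindow, map_mul, ← Complex.exp_conj, Complex.conj_ofReal, Complex.conj_I,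
    Complex.ofReal_exp]
  simp only [← Complex.ofReal_exp]
  simp only [Complex.ofReal_exp, ← Complex.exp_add]
  congr 1
  push_cast at hphase' hnorm' ⊢
  linear_combination (2 * π * Complex.I) * hphase' - π * hnorm'

theorem wigner_gaussWindow (z w : PhaseSpace d) (x ξ : EuclideanSpace ℝ (Fin d)) :
    ∫ y : EuclideanSpace ℝ (Fin d),
      Complex.exp (-(((2 * π * ⟪y, ξ⟫ : ℝ) : ℂ) * Complex.I)) *
        (Complex.exp (((2 * π * ⟪z.2, x + (1 / 2 : ℝ) • y⟫ : ℝ) : ℂ) * Complex.I) *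
          gaussWindow (x + (1 / 2 : ℝ) • y - z.1)) *
        (starRingEnd ℂ) (Complex.exp
          (((2 * π * ⟪w.2, x - (1 / 2 : ℝ) • y⟫ : ℝ) : ℂ) * Complex.I) *
          gaussWindow (x - (1 / 2 : ℝ) • y - w.1)) =
      (((π / (π / 2) : ℝ) : ℂ) ^ (d / 2 : ℂ) *
        Complex.exp (((-(π * ⟪w.1 - z.1, z.2 + w.2⟫) : ℝ) : ℂ) * Complex.I)) *
      gaborAtom (2 * π) ((1 / 2 : ℝ) • (z + w)) (w.2 - z.2, z.1 - w.1) (x, ξ) := by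
  rw [← integral_sub_right_eq_self _ (w.1 - z.1)]
  simp only [wigner_gaussWindow_integrand]
  rw [integral_const_mul, integral_gaussian_phase (by positivity)]
  have h₁ : π ^ 2 / (π / 2) = 2 * π := by field_simp
  rw [h₁, mul_left_comm, mul_assoc (_ ^ _)]
  congr 1
  have h₂ : ⟪z.1 - w.1, ξ⟫ = -⟪w.1 - z.1, ξ⟫ := by rw [← inner_neg_left, neg_sub]
  simp only [gaborAtom, phaseInner, sqNorm2, h₂, Complex.ofReal_exp, ← Complex.exp_add,
    Prod.fst_sub, Prod.snd_sub, Prod.smul_fst, Prod.smul_snd, Prod.fst_add, Prod.snd_add]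
  congr 1
  push_cast
  ring

end Wigner

section Equivalence

open SchwartzMap

variable {d : ℕ} {win win₂ : PhaseSpace d → PhaseSpace d → 𝓢(PhaseSpace d, ℂ)}

theorem continuous_apply_win (hwin : ∀ u ζ v, win u ζ v = gaborAtom π u ζ v)
    (hwin₂ : ∀ u ζ v, win₂ u ζ v = gaborAtom (2 * π) u ζ v)
    (σ : 𝓢(PhaseSpace d, ℂ) →L[ℂ] ℂ) (u : PhaseSpace d) :
    Continuous fun ζ => σ (win u ζ) := by
  have h0 (ζ : PhaseSpace d) : win 0 u (-ζ) ≠ 0 := by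
    rw [hwin]; exact gaborAtom_ne_zero _ _ _ _
  have h := (((win 0 u).continuous.comp continuous_neg).inv₀ h0).mul
    ((narrow_eq_integral hwin hwin₂ σ u 0).1.comp continuous_neg)
  refine h.congr fun ζ => ?_
  change (win 0 u (-ζ))⁻¹ * (win 0 u (-ζ) * σ (win u (0 - -ζ))) = _
  rw [inv_mul_cancel_left₀ (h0 ζ), zero_sub, neg_neg]

theorem exists_integrable_bound (hwin : ∀ u ζ v, win u ζ v = gaborAtom π u ζ v)
    (hwin₂ : ∀ u ζ v, win₂ u ζ v = gaborAtom (2 * π) u ζ v)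
    (σ : 𝓢(PhaseSpace d, ℂ) →L[ℂ] ℂ)
    (h : ∫⁻ ζ, ⨆ u, (‖σ (win u ζ)‖₊ : ℝ≥0∞) < ⊤) :
    ∃ H : PhaseSpace d → ℝ, Integrable H ∧ ∀ u ζ, ‖σ (win₂ u ζ)‖ ≤ H ζ := by
  let S : PhaseSpace d → ℝ≥0∞ := fun ζ => ⨆ u, (‖σ (win u ζ)‖₊ : ℝ≥0∞)
  let γ : PhaseSpace d → ℝ≥0∞ := fun η => ‖win 0 0 η‖ₑ
  let T : PhaseSpace d → ℝ≥0∞ := fun ζ => ∫⁻ η, γ η * S (ζ - η)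
  have hSm : Measurable S := by
    refine (lowerSemicontinuous_iSup fun u => Continuous.lowerSemicontinuous ?_).measurable
    exact ENNReal.continuous_coe.comp (continuous_apply_win hwin hwin₂ σ u).nnnorm
  have hγm : Measurable γ := (win 0 0).continuous.enorm.measurable
  have hprod : Measurable fun p : PhaseSpace d × PhaseSpace d => γ p.2 * S (p.1 - p.2) :=
    (hγm.comp measurable_snd).mul (hSm.comp (measurable_fst.sub measurable_snd))
  have hγ (η : PhaseSpace d) : γ η ≤ 1 := by
    have := norm_gaborAtom_zero_le_one pi_pos.le 0 0 η
    rw [← hwin] at this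
    simpa [γ, enorm_eq_nnnorm, ← NNReal.coe_le_coe] using this
  have hT (ζ : PhaseSpace d) : T ζ < ⊤ := calc
    T ζ ≤ ∫⁻ η, S (ζ - η) := lintegral_mono fun η => mul_le_of_le_one_left' (hγ η)
    _ = ∫⁻ η, S η := lintegral_sub_left_eq_self S ζ
    _ < ⊤ := h
  have hTi : ∫⁻ ζ, T ζ < ⊤ := by
    have : ∫⁻ ζ, T ζ = (∫⁻ η, γ η) * ∫⁻ ζ, S ζ := by
      rw [lintegral_lintegral_swap hprod.aemeasurable, ← lintegral_mul_const _ hγm]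
      refine lintegral_congr fun η => ?_
      rw [lintegral_const_mul _ (f := fun ζ => S (ζ - η)) (hSm.comp (measurable_id.sub_const η)),
        lintegral_sub_right_eq_self S η]
    rw [this]
    exact ENNReal.mul_lt_top (win 0 0).integrable.2 h
  refine ⟨fun ζ => (T ζ).toReal,
    integrable_toReal_of_lintegral_ne_top hprod.lintegral_prod_right'.aemeasurable hTi.ne,
    fun u ζ => ?_⟩
  have hle : ‖σ (win₂ u ζ)‖ₑ ≤ T ζ := by
    rw [(narrow_eq_integral hwin hwin₂ σ u ζ).2]
    refine (enorm_integral_le_lintegral_enorm _).trans (lintegral_mono fun η => ?_)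
    have h₁ : ‖win 0 u η‖ₑ = γ η := by
      simp only [γ, ← ofReal_norm, hwin, norm_gaborAtom]
    rw [enorm_mul, h₁]
    exact mul_le_mul_right (le_iSup (fun u => (‖σ (win u (ζ - η))‖₊ : ℝ≥0∞)) u) _
  rw [← toReal_enorm]
  exact ENNReal.toReal_mono (hT ζ).ne hle

theorem lintegral_iSup_lt_top (hwin : ∀ u ζ v, win u ζ v = gaborAtom π u ζ v)
    (hwin₂ : ∀ u ζ v, win₂ u ζ v = gaborAtom (2 * π) u ζ v)
    (σ : 𝓢(PhaseSpace d, ℂ) →L[ℂ] ℂ) {H : PhaseSpace d → ℝ} (hH : Integrable H)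
    (h : ∀ u ζ, ‖σ (win₂ u ζ)‖ ≤ H ζ) :
    ∫⁻ ζ, ⨆ u, (‖σ (win u ζ)‖₊ : ℝ≥0∞) < ⊤ := by
  let κ : ℂ := (((π / (4 * π) : ℝ) : ℂ) ^ (d / 2 : ℂ)) ^ 2
  have hκ : 0 < ‖κ‖ := by
    have : (0 : ℝ) < π / (4 * π) := by positivity
    rw [norm_pos_iff]
    exact pow_ne_zero _ (Complex.cpow_ne_zero_iff.2 (.inl (by exact_mod_cast this.ne')))
  have hle (u ζ : PhaseSpace d) : ‖σ (win u ζ)‖ ≤ (∫ s, ‖win₂ 0 0 s‖) / ‖κ‖ * H ζ := by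
    have h₁ : ‖κ * σ (win u ζ)‖ ≤ ∫ s, ‖win₂ 0 0 s‖ * H ζ := by
      rw [wide_eq_integral hwin hwin₂ σ u ζ]
      refine norm_integral_le_of_norm_le ((win₂ 0 0).integrable.norm.mul_const _) (.of_forall ?_)
      intro s
      rw [norm_mul]
      exact mul_le_mul_of_nonneg_left (h _ _) (norm_nonneg _)
    rw [norm_mul, integral_mul_const] at h₁
    rw [div_mul_eq_mul_div, le_div_iff₀ hκ]
    linarith
  refine lt_of_le_of_lt (lintegral_mono fun ζ => iSup_le fun u => ?_)
    (hH.const_mul ((∫ s, ‖win₂ 0 0 s‖) / ‖κ‖)).lintegral_lt_top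
  rw [← enorm_eq_nnnorm, ← ofReal_norm]
  exact ENNReal.ofReal_le_ofReal (hle u ζ)

theorem exists_narrow_window (hwin : ∀ u ζ v, win u ζ v = gaborAtom π u ζ v) :
    ∃ win₂ : PhaseSpace d → PhaseSpace d → 𝓢(PhaseSpace d, ℂ),
      ∀ u ζ v, win₂ u ζ v = gaborAtom (2 * π) u ζ v := by
  refine ⟨fun u ζ => smulLeftCLM ℂ (win u 0) (win u ζ), fun u ζ v => ?_⟩
  have h0 : phaseInner 0 v = 0 := by simp [phaseInner]
  rw [smulLeftCLM_apply_apply (win u 0).hasTemperateGrowth]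
  simp only [hwin, gaborAtom, h0, smul_eq_mul, Complex.ofReal_exp, ← Complex.exp_add]
  congr 1
  push_cast
  ring

/-- The quarter turn of phase space preserves volume. -/
theorem measurePreserving_quarterTurn : MeasurePreserving
    (fun p : PhaseSpace d => ((p.2, -p.1) : PhaseSpace d)) volume volume :=
  ((MeasurePreserving.id volume).prod (Measure.measurePreserving_neg volume)).comp
    Measure.measurePreserving_swap

end Equivalence

/-- **Almost diagonalization of Weyl operators with Sjöstrand symbols by Gaussian
time-frequency shifts** (Gröchenig): a tempered distribution `σ` on `ℝ^{2d}` belongs to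
the Sjöstrand class `M^{∞,1}(ℝ^{2d})` (i.e. `∫ sup_u |V_G σ(u,ζ)| dζ < ∞`) if and only
if the Gabor matrix `M(z,w) = |σ(W(π(z)g, π(w)g))| = |⟨σ^w π(z)g, π(w)g⟩|` of its Weyl
operator is dominated by `H(w-z)` for some `H ∈ L¹(ℝ^{2d})`. Here `tf z` packages the
time-frequency shift `π(z)g`, `Wig f₁ f₂` the cross-Wigner distribution `W(f₁,f₂)`, and
`win u ζ` the window `v ↦ e^{-2πiζ·v} G(v-u)` defining `V_G σ(u,ζ) = σ(win u ζ)`. -/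
theorem weyl_almost_diagonalization_sjostrand
    {d : ℕ} (hd : 1 ≤ d)
    (σ : SchwartzMap (EuclideanSpace ℝ (Fin d) × EuclideanSpace ℝ (Fin d)) ℂ →L[ℂ] ℂ)
    (tf : EuclideanSpace ℝ (Fin d) × EuclideanSpace ℝ (Fin d) →
      SchwartzMap (EuclideanSpace ℝ (Fin d)) ℂ)
    (htf : ∀ z t, tf z t =
      Complex.exp ((((2 * π * ⟪z.2, t⟫ : ℝ) : ℂ) * Complex.I)) * gaussWindow (t - z.1))
    (Wig : SchwartzMap (EuclideanSpace ℝ (Fin d)) ℂ →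
      SchwartzMap (EuclideanSpace ℝ (Fin d)) ℂ →
      SchwartzMap (EuclideanSpace ℝ (Fin d) × EuclideanSpace ℝ (Fin d)) ℂ)
    (hWig : ∀ f₁ f₂ x ξ, Wig f₁ f₂ (x, ξ) =
      ∫ (y : EuclideanSpace ℝ (Fin d)),
        Complex.exp (-(((2 * π * ⟪y, ξ⟫ : ℝ) : ℂ) * Complex.I)) *
          f₁ (x + (1 / 2 : ℝ) • y) * (starRingEnd ℂ) (f₂ (x - (1 / 2 : ℝ) • y)))
    (win : EuclideanSpace ℝ (Fin d) × EuclideanSpace ℝ (Fin d) →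
      EuclideanSpace ℝ (Fin d) × EuclideanSpace ℝ (Fin d) →
      SchwartzMap (EuclideanSpace ℝ (Fin d) × EuclideanSpace ℝ (Fin d)) ℂ)
    (hwin : ∀ u ζ v, win u ζ v =
      Complex.exp (-(((2 * π * (⟪ζ.1, v.1⟫ + ⟪ζ.2, v.2⟫) : ℝ) : ℂ) * Complex.I)) *
        gaussWindow2 (v - u)) :
    ((∫⁻ ζ : EuclideanSpace ℝ (Fin d) × EuclideanSpace ℝ (Fin d),
        ⨆ u : EuclideanSpace ℝ (Fin d) × EuclideanSpace ℝ (Fin d),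
          (‖σ (win u ζ)‖₊ : ℝ≥0∞)) < ⊤) ↔
      (∃ H : EuclideanSpace ℝ (Fin d) × EuclideanSpace ℝ (Fin d) → ℝ,
        Integrable H ∧ ∀ z w : EuclideanSpace ℝ (Fin d) × EuclideanSpace ℝ (Fin d),
          ‖σ (Wig (tf z) (tf w))‖ ≤ H (w - z)) := by
  have hwin' (u ζ v : PhaseSpace d) : win u ζ v = gaborAtom π u ζ v := by
    rw [hwin, gaborAtom, gaussWindow2, phaseInner, sqNorm2, Complex.ofReal_neg, ← neg_mul]
  obtain ⟨win₂, hwin₂⟩ := exists_narrow_window hwin'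
  let c : ℂ := ((π / (π / 2) : ℝ) : ℂ) ^ (d / 2 : ℂ)
  have hc : 0 < ‖c‖ := by
    have : (0 : ℝ) < π / (π / 2) := by positivity
    rw [norm_pos_iff]
    exact Complex.cpow_ne_zero_iff.2 (.inl (by exact_mod_cast this.ne'))
  have key (z w : PhaseSpace d) : ‖σ (Wig (tf z) (tf w))‖ =
      ‖c‖ * ‖σ (win₂ ((1 / 2 : ℝ) • (z + w)) (w.2 - z.2, z.1 - w.1))‖ := by
    have : Wig (tf z) (tf w) =
        (c * Complex.exp (((-(π * ⟪w.1 - z.1, z.2 + w.2⟫) : ℝ) : ℂ) * Complex.I)) •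
          win₂ ((1 / 2 : ℝ) • (z + w)) (w.2 - z.2, z.1 - w.1) := by
      ext ⟨x, ξ⟩
      simp only [hWig, htf, wigner_gaussWindow, _root_.smul_apply, hwin₂, smul_eq_mul, c]
    rw [this, map_smul, norm_smul, norm_mul, Complex.norm_exp_ofReal_mul_I, mul_one]
  constructor
  · intro h
    obtain ⟨H, hH, hb⟩ := exists_integrable_bound hwin' hwin₂ σ h
    refine ⟨fun p => ‖c‖ * H (p.2, -p.1),
      (measurePreserving_quarterTurn.integrable_comp_of_integrable hH).const_mul _,
      fun z w => ?_⟩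
    have h₁ : z.1 - w.1 = -(w - z).1 := by simp
    rw [key, h₁, ← Prod.snd_sub]
    exact mul_le_mul_of_nonneg_left (hb _ _) hc.le
  · rintro ⟨H, hH, hb⟩
    refine lintegral_iSup_lt_top hwin' hwin₂ σ (H := fun p => ‖c‖⁻¹ * H (-(p.2, -p.1)))
      ((measurePreserving_quarterTurn.integrable_comp_of_integrable hH.comp_neg).const_mul _)
      fun u ζ => ?_
    let r : PhaseSpace d := -(ζ.2, -ζ.1)
    have h := hb (u - (1 / 2 : ℝ) • r) (u + (1 / 2 : ℝ) • r)
    have h₁ : u + (1 / 2 : ℝ) • r - (u - (1 / 2 : ℝ) • r) = r := by module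
    have h₂ : (1 / 2 : ℝ) • (u - (1 / 2 : ℝ) • r + (u + (1 / 2 : ℝ) • r)) = u := by module
    have h₃ : ((u + (1 / 2 : ℝ) • r).2 - (u - (1 / 2 : ℝ) • r).2,
        (u - (1 / 2 : ℝ) • r).1 - (u + (1 / 2 : ℝ) • r).1) = ζ := by
      rw [← Prod.snd_sub, ← neg_sub (_ : PhaseSpace d).1, ← Prod.fst_sub, h₁]
      simp [r]
    rw [key, h₁, h₂, h₃] at h
    rwa [inv_mul_eq_div, le_div_iff₀ hc, mul_comm]
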